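/- Let L > 0, γ ∈ ℝ, δ > 0, T > 0, and let u : ℝ × [0,T) → ℂ be continuously differentiable in t, twice continuously differentiable in x, 2L-periodic in x, satisfy i∂ₜu + (1/2)∂ₓ²u + |u|²u = iγu + iδ|u|²u pointwise on ℝ × [0,T), and assume M(0) > 0, where M(t) = (e^{-2γt}/(2L)) ∫_{-L}^{L} |u(x,t)|² dx. Then M(t) is strictly monotonically increasing on [0,T): 0 < M(0) < M(t) for all t ∈ (0,T). -/

import Mathlib

open MeasureTheory intervalIntegral Set

/-- Continuity of a parametric integral, for an integrand that is continuous on a strip. -/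
lemma continuousOn_parametric_intervalIntegral {f : ℝ → ℝ → ℝ} {c d : ℝ} (hcd : c ≤ d)
    (hf : ContinuousOn (fun p : ℝ × ℝ => f p.1 p.2) (univ ×ˢ Icc c d)) (a b : ℝ) :
    ContinuousOn (fun t => ∫ x in a..b, f x t) (Icc c d) := by
  have hcont : Continuous (Function.uncurry fun t x : ℝ => f x (projIcc c d hcd t)) := by
    refine hf.comp_continuous
      (f := fun p : ℝ × ℝ => (p.2, (projIcc c d hcd p.1 : ℝ))) (by fun_prop) ?_
    exact fun p => ⟨mem_univ _, (projIcc c d hcd p.1).2⟩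
  refine (continuous_parametric_intervalIntegral_of_continuous' (μ := volume)
    hcont a b).continuousOn.congr fun t ht => ?_
  simp only [projIcc_of_mem hcd ht]

/-- Differentiation under the integral sign, for an integrand that is continuous together with its
derivative on an open strip. -/
lemma hasDerivAt_parametric_intervalIntegral {f f' : ℝ → ℝ → ℝ} {c d : ℝ}
    (hf : ContinuousOn (fun p : ℝ × ℝ => f p.1 p.2) (univ ×ˢ Ioo c d))
    (hf' : ContinuousOn (fun p : ℝ × ℝ => f' p.1 p.2) (univ ×ˢ Ioo c d))
    (hderiv : ∀ x, ∀ t ∈ Ioo c d, HasDerivAt (f x) (f' x t) t) (a b : ℝ)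
    {t : ℝ} (ht : t ∈ Ioo c d) :
    HasDerivAt (fun s => ∫ x in a..b, f x s) (∫ x in a..b, f' x t) t := by
  have hslice : ∀ {g : ℝ → ℝ → ℝ},
      ContinuousOn (fun p : ℝ × ℝ => g p.1 p.2) (univ ×ˢ Ioo c d) →
      ∀ s ∈ Ioo c d, Continuous fun x => g x s := fun hg s hs =>
    hg.comp_continuous (f := fun x : ℝ => (x, s)) (by fun_prop) fun x => ⟨mem_univ _, hs⟩
  obtain ⟨c', hc, hc'⟩ := exists_between ht.1
  obtain ⟨d', hd', hd⟩ := exists_between ht.2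
  have hsub : Icc c' d' ⊆ Ioo c d := fun s hs => ⟨hc.trans_le hs.1, hs.2.trans_lt hd⟩
  obtain ⟨C, hC⟩ := (isCompact_uIcc.prod isCompact_Icc).exists_bound_of_continuousOn
    (hf'.mono (prod_mono (subset_univ (uIcc a b)) hsub))
  refine (intervalIntegral.hasDerivAt_integral_of_dominated_loc_of_deriv_le
    (F := fun s x => f x s) (F' := fun s x => f' x s) (bound := fun _ => C)
    (Icc_mem_nhds hc' hd') ?_ ((hslice hf t ht).intervalIntegrable a b)
    (hslice hf' t ht).aestronglyMeasurable ?_ (by simp) ?_).2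
  · filter_upwards [Ioo_mem_nhds ht.1 ht.2] with s hs
    exact (hslice hf s hs).aestronglyMeasurable
  · exact .of_forall fun x hx s hs => hC (x, s) ⟨uIoc_subset_uIcc hx, hs⟩
  · exact .of_forall fun x _ s hs => hderiv x s (hsub hs)

/-- The squared norm of a complex curve has derivative `2 Re (conj f * f')`. -/
lemma HasDerivAt.complex_norm_sq {f : ℝ → ℂ} {f' : ℂ} {t : ℝ} (hf : HasDerivAt f f' t) :
    HasDerivAt (fun s => ‖f s‖ ^ 2) (2 * ((f t).re * f'.re + (f t).im * f'.im)) t := by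
  have hre : HasDerivAt (fun s => (f s).re) f'.re t :=
    Complex.reCLM.hasFDerivAt.comp_hasDerivAt t hf
  have him : HasDerivAt (fun s => (f s).im) f'.im t :=
    Complex.imCLM.hasFDerivAt.comp_hasDerivAt t hf
  refine ((hre.pow 2).add (him.pow 2)).congr_deriv ?_ |>.congr_of_eventuallyEq ?_
  · push_cast; ring
  · refine .of_forall fun s => ?_
    simp only [Pi.add_apply, Pi.pow_apply, Complex.sq_norm, Complex.normSq_apply]
    ring

/-- Integration of `Im (conj f * f'')` over a full period gives zero. -/
lemma integral_im_conj_mul_deriv_eq_zero {f f' f'' : ℝ → ℂ} {a b : ℝ}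
    (hf : ∀ x, HasDerivAt f (f' x) x) (hf' : ∀ x, HasDerivAt f' (f'' x) x)
    (hf'' : Continuous f'') (hper : Function.Periodic f (b - a)) :
    ∫ x in a..b, ((f x).re * (f'' x).im - (f x).im * (f'' x).re) = 0 := by
  have hper' : Function.Periodic f' (b - a) := fun x => by
    refine ((hf (x + (b - a))).comp_add_const x (b - a)).unique ?_
    rw [show (fun y => f (y + (b - a))) = f from funext hper]
    exact hf x
  have hfc : Continuous f := continuous_iff_continuousAt.2 fun x => (hf x).continuousAt
  have hderiv : ∀ x, HasDerivAt (fun y => (f y).re * (f' y).im - (f y).im * (f' y).re)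
      ((f x).re * (f'' x).im - (f x).im * (f'' x).re) x := fun x => by
    have h1 : HasDerivAt (fun y => (f y).re) (f' x).re x :=
      Complex.reCLM.hasFDerivAt.comp_hasDerivAt x (hf x)
    have h2 : HasDerivAt (fun y => (f y).im) (f' x).im x :=
      Complex.imCLM.hasFDerivAt.comp_hasDerivAt x (hf x)
    have h3 : HasDerivAt (fun y => (f' y).re) (f'' x).re x :=
      Complex.reCLM.hasFDerivAt.comp_hasDerivAt x (hf' x)
    have h4 : HasDerivAt (fun y => (f' y).im) (f'' x).im x :=
      Complex.imCLM.hasFDerivAt.comp_hasDerivAt x (hf' x)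
    exact ((h1.mul h4).sub (h2.mul h3)).congr_deriv (by ring)
  rw [integral_eq_sub_of_hasDerivAt (fun x _ => hderiv x)
    (Continuous.intervalIntegrable (by fun_prop) a b)]
  have h := hper a
  have h' := hper' a
  rw [add_sub_cancel] at h h'
  simp [h, h']

/-- If a continuous function has positive mean square, it has positive mean fourth power. -/
lemma integral_pow_four_pos {f : ℝ → ℝ} {a b : ℝ} (hf : Continuous f) (hab : a < b)
    (h : 0 < ∫ x in a..b, f x ^ 2) : 0 < ∫ x in a..b, f x ^ 4 := by
  set N := ∫ x in a..b, f x ^ 2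
  have hba : 0 < b - a := sub_pos.2 hab
  have hle : ∫ x in a..b, (2 * (N / (b - a)) * f x ^ 2 - (N / (b - a)) ^ 2)
      ≤ ∫ x in a..b, f x ^ 4 := by
    refine integral_mono_on hab.le (Continuous.intervalIntegrable (by fun_prop) a b)
      (Continuous.intervalIntegrable (by fun_prop) a b) fun x _ => ?_
    nlinarith [sq_nonneg (f x ^ 2 - N / (b - a))]
  rw [integral_sub (Continuous.intervalIntegrable (by fun_prop) a b)
    (Continuous.intervalIntegrable (by fun_prop) a b), intervalIntegral.integral_const_mul,
    intervalIntegral.integral_const, smul_eq_mul] at hle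
  refine lt_of_lt_of_le ?_ hle
  have : 2 * (N / (b - a)) * N - (b - a) * (N / (b - a)) ^ 2 = N ^ 2 / (b - a) := by
    field_simp; ring
  rw [show (∫ x in a..b, f x ^ 2) = N from rfl, this]
  positivity

/-- **Strict monotonicity of the energy functional in the collapse regime `δ > 0`.**
For a classical, `2L`-periodic solution of `i∂ₜu + (1/2)∂ₓ²u + |u|²u = iγu + iδ|u|²u`
on `ℝ × [0,T)` with `δ > 0` and `M(0) > 0`, where
`M(t) = (e^{-2γt}/(2L)) ∫_{-L}^{L} |u|² dx`, one has `0 < M(0) < M(t)` for all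
`t ∈ (0,T)`. -/
theorem energy_functional_strictly_increasing
    (L γ δ T : ℝ) (hL : 0 < L) (hδ : 0 < δ) (hT : 0 < T)
    (u ut ux uxx : ℝ → ℝ → ℂ)
    (hut : ∀ (x : ℝ), ∀ t ∈ Set.Ico (0 : ℝ) T,
      HasDerivWithinAt (fun τ => u x τ) (ut x t) (Set.Ico (0 : ℝ) T) t)
    (hux : ∀ (x : ℝ), ∀ t ∈ Set.Ico (0 : ℝ) T,
      HasDerivAt (fun y => u y t) (ux x t) x)
    (huxx : ∀ (x : ℝ), ∀ t ∈ Set.Ico (0 : ℝ) T,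
      HasDerivAt (fun y => ux y t) (uxx x t) x)
    (hu_cont : ContinuousOn (fun p : ℝ × ℝ => u p.1 p.2) (Set.univ ×ˢ Set.Ico 0 T))
    (hut_cont : ContinuousOn (fun p : ℝ × ℝ => ut p.1 p.2) (Set.univ ×ˢ Set.Ico 0 T))
    (hux_cont : ContinuousOn (fun p : ℝ × ℝ => ux p.1 p.2) (Set.univ ×ˢ Set.Ico 0 T))
    (huxx_cont : ContinuousOn (fun p : ℝ × ℝ => uxx p.1 p.2) (Set.univ ×ˢ Set.Ico 0 T))
    (hper : ∀ (x t : ℝ), u (x + 2 * L) t = u x t)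
    (hpde : ∀ (x : ℝ), ∀ t ∈ Set.Ico (0 : ℝ) T,
      Complex.I * ut x t + (1 / 2 : ℂ) * uxx x t + (‖u x t‖ : ℂ) ^ 2 * u x t
        = Complex.I * (γ : ℂ) * u x t
          + Complex.I * (δ : ℂ) * (‖u x t‖ : ℂ) ^ 2 * u x t)
    (M : ℝ → ℝ)
    (hM : ∀ t : ℝ, M t = Real.exp (-2 * γ * t) / (2 * L) * ∫ x in (-L)..L, ‖u x t‖ ^ 2)
    (hM0 : 0 < M 0) :
    ∀ t ∈ Set.Ioo (0 : ℝ) T, 0 < M 0 ∧ M 0 < M t := by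
  intro t ht
  refine ⟨hM0, ?_⟩
  have hslice : ∀ {g : ℝ → ℝ → ℂ},
      ContinuousOn (fun p : ℝ × ℝ => g p.1 p.2) (univ ×ˢ Ico 0 T) →
      ∀ s ∈ Ico 0 T, Continuous fun x => g x s := fun hg s hs =>
    hg.comp_continuous (f := fun x : ℝ => (x, s)) (by fun_prop) fun x => ⟨mem_univ _, hs⟩
  have hmass_deriv : ∀ s ∈ Ioo 0 T, HasDerivAt (fun τ => ∫ x in (-L)..L, ‖u x τ‖ ^ 2)
      (2 * γ * (∫ x in (-L)..L, ‖u x s‖ ^ 2) + 2 * δ * ∫ x in (-L)..L, ‖u x s‖ ^ 4) s := by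
    intro s hs
    have hs' := Ioo_subset_Ico_self hs
    have hu' := hu_cont.mono (prod_mono_right (s := univ) (Ioo_subset_Ico_self (a := 0) (b := T)))
    have hut' := hut_cont.mono (prod_mono_right (s := univ) (Ioo_subset_Ico_self (a := 0) (b := T)))
    have hus := hslice hu_cont s hs'
    have huxxs := hslice huxx_cont s hs'
    refine (hasDerivAt_parametric_intervalIntegral
      (f' := fun x τ => 2 * ((u x τ).re * (ut x τ).re + (u x τ).im * (ut x τ).im))
      (hu'.norm.pow 2) ?_ (fun x τ hτ => HasDerivAt.complex_norm_sq
        ((hut x τ (Ioo_subset_Ico_self hτ)).hasDerivAt (Ico_mem_nhds hτ.1 hτ.2)))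
      (-L) L hs).congr_deriv ?_
    · have := Complex.continuous_re.comp_continuousOn hu'
      have := Complex.continuous_im.comp_continuousOn hu'
      have := Complex.continuous_re.comp_continuousOn hut'
      have := Complex.continuous_im.comp_continuousOn hut'
      simp only [Function.comp_def] at *
      fun_prop
    · have hflux := integral_im_conj_mul_deriv_eq_zero (a := -L) (b := L)
        (fun x => hux x s hs') (fun x => huxx x s hs') huxxs
        (fun x => by rw [show L - -L = 2 * L by ring]; exact hper x s)
      have hpoint : ∀ x, 2 * ((u x s).re * (ut x s).re + (u x s).im * (ut x s).im)
          = 2 * γ * ‖u x s‖ ^ 2 + 2 * δ * ‖u x s‖ ^ 4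
            - ((u x s).re * (uxx x s).im - (u x s).im * (uxx x s).re) := by
        intro x
        have hn : ‖u x s‖ ^ 2 = (u x s).re * (u x s).re + (u x s).im * (u x s).im := by
          rw [Complex.sq_norm, Complex.normSq_apply]
        have hp := hpde x s hs'
        rw [← Complex.ofReal_pow] at hp
        have hre := congrArg Complex.re hp
        have him := congrArg Complex.im hp
        simp [-Complex.ofReal_pow] at hre him
        rw [show ‖u x s‖ ^ 4 = (‖u x s‖ ^ 2) ^ 2 by ring]
        simp only [hn] at hre him ⊢
        linear_combination 2 * (u x s).re * him - 2 * (u x s).im * hre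
      simp only [hpoint]
      rw [integral_sub (Continuous.intervalIntegrable (by fun_prop) _ _)
        (Continuous.intervalIntegrable (by fun_prop) _ _), hflux,
        integral_add (Continuous.intervalIntegrable (by fun_prop) _ _)
        (Continuous.intervalIntegrable (by fun_prop) _ _), intervalIntegral.integral_const_mul,
        intervalIntegral.integral_const_mul, sub_zero]
  have hM_deriv : ∀ s ∈ Ioo 0 T, HasDerivAt M
      (δ * Real.exp (-2 * γ * s) / L * ∫ x in (-L)..L, ‖u x s‖ ^ 4) s := by
    intro s hs
    rw [show M = _ from funext hM]
    have hexp : HasDerivAt (fun τ => Real.exp (-2 * γ * τ) / (2 * L))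
        (Real.exp (-2 * γ * s) * (-2 * γ) / (2 * L)) s := by
      simpa using (((hasDerivAt_id s).const_mul (-2 * γ)).exp).div_const (2 * L)
    refine (hexp.mul (hmass_deriv s hs)).congr_deriv ?_
    field_simp
    ring
  have hIcc : Icc 0 t ⊆ Ico 0 T := fun s hs => ⟨hs.1, hs.2.trans_lt ht.2⟩
  have hIoo : Ioo 0 t ⊆ Ioo 0 T := Ioo_subset_Ioo_right ht.2.le
  have hM_cont : ContinuousOn M (Icc 0 t) := by
    rw [show M = _ from funext hM]
    refine ContinuousOn.mul (by fun_prop) ?_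
    exact continuousOn_parametric_intervalIntegral (f := fun x s => ‖u x s‖ ^ 2) ht.1.le
      ((hu_cont.mono (prod_mono_right hIcc)).norm.pow 2) _ _
  have hmono : MonotoneOn M (Icc 0 t) := by
    refine monotoneOn_of_deriv_nonneg (convex_Icc 0 t) hM_cont ?_ ?_ <;> rw [interior_Icc]
    · exact fun s hs => (hM_deriv s (hIoo hs)).differentiableAt.differentiableWithinAt
    · intro s hs
      rw [(hM_deriv s (hIoo hs)).deriv]
      have := integral_nonneg (μ := volume) (show -L ≤ L by linarith)
        (fun x _ => by positivity : ∀ x ∈ Icc (-L) L, 0 ≤ ‖u x s‖ ^ 4)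
      positivity
  refine strictMonoOn_of_deriv_pos (convex_Icc 0 t) hM_cont ?_ (left_mem_Icc.2 ht.1.le)
    (right_mem_Icc.2 ht.1.le) ht.1
  rw [interior_Icc]
  intro s hs
  rw [(hM_deriv s (hIoo hs)).deriv]
  have hMs : 0 < M s :=
    hM0.trans_le (hmono (left_mem_Icc.2 ht.1.le) (Ioo_subset_Icc_self hs) hs.1.le)
  rw [hM] at hMs
  have := integral_pow_four_pos (hslice hu_cont s (hIcc (Ioo_subset_Icc_self hs))).norm
    (show -L < L by linarith) (pos_of_mul_pos_right hMs (by positivity))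
  positivity
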